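/- Fused RTT Yang–Baxter equation (Theorem B): for every m ≥ 1, every q, Φ ∈ ℂ* and α as specified, every z₁, z₂ ∈ ℂ*, all boundary spins a, b, d, e ∈ {+, c_1, …, c_m} and all subsets C, F ⊆ {c_1, …, c_m}: ∑_{i, j ∈ {+,c_1,…,c_m}} ∑_{K ⊆ {c_1,…,c_m}} R(z₁,z₂)(a,b;i,j) · wt^{z₁}(i,C,d,K) · wt^{z₂}(j,K,e,F) = ∑_{l, m' ∈ {+,c_1,…,c_m}} ∑_{N ⊆ {c_1,…,c_m}} wt^{z₂}(b,C,l,N) · wt^{z₁}(a,N,m',F) · R(z₁,z₂)(m',l;d,e). -/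

import Mathlib

noncomputable section

/-- A spin: either `+` (`none`) or a color `c_i` represented by the residue class
`i mod m` of its index `i ∈ {1, …, m}` (`some` of that class). -/
abbrev Spin (m : ℕ) := Option (ZMod m)

/-- The representative in `{1, …, m}` of a residue class mod `m`. -/
def rep (m : ℕ) (x : ZMod m) : ℕ := (x - 1).val + 1

/-- Boltzmann weight of a T-vertex with column color (class) `j` and row parameter `z`,
on the spins `(a, b, c, d)` of its (left, top, right, bottom) edges; inadmissible
configurations get weight `0`. -/
def wt (m : ℕ) (q Φ : ℂ) (α : ZMod m → ZMod m → ℂ) (j : ZMod m) (z : ℂ) :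
    Spin m → Spin m → Spin m → Spin m → ℂ
  | some a, some b, some c, some d =>
      if b = j ∧ d = j ∧ c = a then (if a = j then Φ * q * z else Φ * α (-a) (-j)) else 0
  | none, some b, none, some d => if b = j ∧ d = j then -Φ / q else 0
  | some a, none, some c, none => if c = a then (if a = j then z else 1) else 0
  | some a, none, none, some d => if a = j ∧ d = j then -(Φ / q) * (1 - q ^ 2) * z else 0
  | none, some b, some c, none => if b = j ∧ c = j then 1 else 0
  | none, none, none, none => 1
  | _, _, _, _ => 0

/-- The fused R-matrix `R(z, w)(a, b; c, d)`, where `a` is the input spin on the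
`z`-line, `b` the input on the `w`-line, `c` the output on the `z`-line and `d` the
output on the `w`-line; colors are compared via their representatives in `{1, …, m}`. -/
def Rf (m : ℕ) (q Φ : ℂ) (α : ZMod m → ZMod m → ℂ) (z w : ℂ) :
    Spin m → Spin m → Spin m → Spin m → ℂ
  | none, none, none, none => z - q ^ 2 * w
  | some a, some b, some c, some d =>
      if a = b then (if c = a ∧ d = a then w - q ^ 2 * z else 0)
      else if c = b ∧ d = a then (1 - q ^ 2) * (if rep m a < rep m b then z else w)
      else if c = a ∧ d = b then -q * (z - w) * α (-a) (-b)
      else 0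
  | some a, none, none, some d => if d = a then (1 - q ^ 2) * z else 0
  | none, some b, some c, none => if c = b then (1 - q ^ 2) * w else 0
  | none, some b, none, some d => if d = b then -q * (z - w) * Φ else 0
  | some a, none, some c, none => if c = a then -q * (z - w) / Φ else 0
  | _, _, _, _ => 0

/-- The fused T-weight `wt^z(A, B, C, D)`: the weight of the unique admissible
configuration of a single row of `m` T-vertices with column colors `c_1, …, c_m` from
left to right, left boundary spin `A`, right boundary spin `C`, and top resp. bottom
vertical edges colored according to the subsets `B` resp. `D` of the palette (a subset
is recorded by the set of residue classes of the color indices).  Since inadmissible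
configurations have weight `0` and at most one admissible configuration of the interior
horizontal edges exists, this weight equals the sum over all interior configurations of
the product of the vertex weights. -/
def fusedWt (m : ℕ) [NeZero m] (q Φ : ℂ) (α : ZMod m → ZMod m → ℂ) (z : ℂ)
    (A : Spin m) (B : Finset (ZMod m)) (C : Spin m) (D : Finset (ZMod m)) : ℂ :=
  ∑ h : Fin (m + 1) → Spin m,
    if h 0 = A ∧ h (Fin.last m) = C then
      ∏ t : Fin m,
        wt m q Φ α (((t : ℕ) + 1 : ℕ) : ZMod m) z (h t.castSucc)
          (if ((((t : ℕ) + 1 : ℕ) : ZMod m)) ∈ B then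
            some ((((t : ℕ) + 1 : ℕ) : ZMod m)) else none)
          (h t.succ)
          (if ((((t : ℕ) + 1 : ℕ) : ZMod m)) ∈ D then
            some ((((t : ℕ) + 1 : ℕ) : ZMod m)) else none)
    else 0

/-- The fused R-matrix with colors compared through an arbitrary ranking `r`. -/
def rankedR {m : ℕ} (r : ZMod m → ℕ) (q Φ : ℂ) (α : ZMod m → ZMod m → ℂ) (z w : ℂ) :
    Spin m → Spin m → Spin m → Spin m → ℂ
  | none, none, none, none => z - q ^ 2 * w
  | some a, some b, some c, some d =>
      if a = b then (if c = a ∧ d = a then w - q ^ 2 * z else 0)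
      else if c = b ∧ d = a then (1 - q ^ 2) * (if r a < r b then z else w)
      else if c = a ∧ d = b then -q * (z - w) * α (-a) (-b)
      else 0
  | some a, none, none, some d => if d = a then (1 - q ^ 2) * z else 0
  | none, some b, some c, none => if c = b then (1 - q ^ 2) * w else 0
  | none, some b, none, some d => if d = b then -q * (z - w) * Φ else 0
  | some a, none, some c, none => if c = a then -q * (z - w) / Φ else 0
  | _, _, _, _ => 0

theorem Rf_eq_rankedR (m : ℕ) (q Φ : ℂ) (α : ZMod m → ZMod m → ℂ) (z w : ℂ) :
    Rf m q Φ α z w = rankedR (rep m) q Φ α z w := rfl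

theorem rankedR_congr {m : ℕ} {r r' : ZMod m → ℕ} (h : ∀ x y, r x < r y ↔ r' x < r' y)
    (q Φ : ℂ) (α : ZMod m → ZMod m → ℂ) (z w : ℂ) :
    rankedR r q Φ α z w = rankedR r' q Φ α z w := by
  funext a b c d
  rcases a with _ | a <;> rcases b with _ | b <;> rcases c with _ | c <;> rcases d with _ | d <;>
    simp [rankedR, h]

theorem rankedR_eq_zero {m : ℕ} (r : ZMod m → ℕ) (q Φ : ℂ) (α : ZMod m → ZMod m → ℂ) (z w : ℂ)
    {a b c d : Spin m} (h₁ : ¬(c = a ∧ d = b)) (h₂ : ¬(c = b ∧ d = a)) :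
    rankedR r q Φ α z w a b c d = 0 := by
  rcases a with _ | a <;> rcases b with _ | b <;> rcases c with _ | c <;> rcases d with _ | d <;>
    simp_all [rankedR]
  grind

/-- A double sum supported on `(a, b)` and `(b, a)`. -/
theorem sum_sum_eq_of_support {S M : Type*} [Fintype S] [DecidableEq S] [AddCommMonoid M] (a b : S)
    (f : S → S → M) (h : ∀ i j, ¬(i = a ∧ j = b) → ¬(i = b ∧ j = a) → f i j = 0) :
    ∑ i, ∑ j, f i j = f a b + if a = b then 0 else f b a := by
  rw [← Fintype.sum_prod_type']
  split_ifs with hab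
  · subst hab
    rw [add_zero]
    refine Fintype.sum_eq_single (a, a) fun x hx => ?_
    have hx' : ¬(x.1 = a ∧ x.2 = a) := fun hh => hx (Prod.ext hh.1 hh.2)
    exact h _ _ hx' hx'
  · refine Fintype.sum_eq_add (a, b) (b, a) (by simp [hab]) fun x hx => ?_
    exact h _ _ (fun hh => hx.1 (Prod.ext hh.1 hh.2)) (fun hh => hx.2 (Prod.ext hh.1 hh.2))

/-- The spin on a vertical edge of a column of color `j`. -/
def verticalSpin {m : ℕ} (j : ZMod m) (v : Bool) : Spin m := if v then some j else none

/-- The RTT relation for one column of color `j`. -/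
theorem column_RTT {m : ℕ} [NeZero m] {q Φ : ℂ} (hq : q ≠ 0) (hΦ : Φ ≠ 0)
    (α : ZMod m → ZMod m → ℂ) (hα : ∀ x y, α x y * α y x = 1) (z w : ℂ) (j : ZMod m)
    (r r' : ZMod m → ℕ) (hmin : ∀ y, y ≠ j → r j < r y) (hmax : ∀ y, y ≠ j → r' y < r' j)
    (hrr' : ∀ x y, x ≠ j → y ≠ j → (r x < r y ↔ r' x < r' y)) (a b d e : Spin m) (c f : Bool) :
    ∑ i, ∑ l, ∑ k : Bool, rankedR r q Φ α z w a b i l *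
        (wt m q Φ α j z i (verticalSpin j c) d (verticalSpin j k) *
          wt m q Φ α j w l (verticalSpin j k) e (verticalSpin j f)) =
      ∑ i, ∑ l, ∑ k : Bool, wt m q Φ α j w b (verticalSpin j c) l (verticalSpin j k) *
        wt m q Φ α j z a (verticalSpin j k) i (verticalSpin j f) *
          rankedR r' q Φ α z w i l d e := by
  rw [sum_sum_eq_of_support a b, sum_sum_eq_of_support d e]
  rotate_left
  · intro i l h₁ h₂
    simp only [rankedR_eq_zero r' q Φ α z w (a := i) (b := l) (c := d) (d := e) (by tauto) (by tauto),
      mul_zero, Finset.sum_const_zero]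
  · intro i l h₁ h₂
    simp only [rankedR_eq_zero r q Φ α z w h₁ h₂, zero_mul, Finset.sum_const_zero]
  simp only [Fintype.sum_bool]
  rcases a with _ | a <;> rcases b with _ | b <;> rcases d with _ | d <;> rcases e with _ | e <;>
    cases c <;> cases f <;>
    simp [rankedR, wt, verticalSpin] <;> grind

section Row

variable {S V : Type*} [Fintype S] [DecidableEq S]

/-- The partition function of a row of `n` vertices with weights `W 0, …, W (n - 1)`. -/
def rowWt (W : ℕ → S → V → S → V → ℂ) (n : ℕ) (A : S) (B : Fin n → V) (C : S) (D : Fin n → V) :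
    ℂ :=
  ∑ h : Fin (n + 1) → S,
    if h 0 = A ∧ h (Fin.last n) = C then
      ∏ t : Fin n, W t (h t.castSucc) (B t) (h t.succ) (D t)
    else 0

theorem rowWt_succ (W : ℕ → S → V → S → V → ℂ) (n : ℕ) (A C : S) (B D : Fin n → V) (b d : V) :
    rowWt W (n + 1) A (Fin.snoc B b : Fin (n + 1) → V) C (Fin.snoc D d : Fin (n + 1) → V) =
      ∑ X, rowWt W n A B X D * W n X b C d := by
  have h₁ : ∀ h' : Fin (n + 1) → S, (∑ X, (if h' 0 = A ∧ h' (Fin.last n) = X then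
      ∏ t : Fin n, W t (h' t.castSucc) (B t) (h' t.succ) (D t) else 0) * W n X b C d) =
      if h' 0 = A then (∏ t : Fin n, W t (h' t.castSucc) (B t) (h' t.succ) (D t)) *
        W n (h' (Fin.last n)) b C d else 0 := by
    intro h'
    by_cases hA : h' 0 = A <;> simp [hA, ite_mul]
  simp only [rowWt, Finset.sum_mul]
  rw [Finset.sum_comm, Finset.sum_congr rfl fun h' _ => h₁ h',
    ← (Fin.snocEquiv fun _ => S).sum_comp, Fintype.sum_prod_type, Finset.sum_comm]
  refine Finset.sum_congr rfl fun h' _ => ?_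
  have h₀ : ∀ X, (Fin.snoc h' X : Fin (n + 2) → S) 0 = h' 0 := fun X =>
    Fin.snoc_castSucc (α := fun _ => S) X h' 0
  by_cases hA : h' 0 = A <;>
    simp [Fin.snocEquiv, h₀, hA, Fin.prod_univ_castSucc, Fin.succ_castSucc, -Fin.castSucc_succ]

/-- The transfer matrix of two stacked rows, with weights `W₁` above and `W₂` below. -/
def twoRowMatrix [Fintype V] (W₁ W₂ : ℕ → S → V → S → V → ℂ) (n : ℕ) (B D : Fin n → V) :
    Matrix (S × S) (S × S) ℂ :=
  Matrix.of fun x y => ∑ K, rowWt W₁ n x.1 B y.1 K * rowWt W₂ n x.2 K y.2 D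

/-- The transfer matrix of two stacked vertices. -/
def twoVertexMatrix [Fintype V] (w₁ w₂ : S → V → S → V → ℂ) (b d : V) : Matrix (S × S) (S × S) ℂ :=
  Matrix.of fun x y => ∑ k, w₁ x.1 b y.1 k * w₂ x.2 k y.2 d

theorem twoRowMatrix_zero [Fintype V] (W₁ W₂ : ℕ → S → V → S → V → ℂ) (B D : Fin 0 → V) :
    twoRowMatrix W₁ W₂ 0 B D = 1 := by
  have h : ∀ (W : ℕ → S → V → S → V → ℂ) A B C D,
      rowWt W 0 A B C D = if A = C then 1 else 0 := by
    intro W A B C D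
    rw [rowWt, ← (Equiv.funUnique (Fin 1) S).symm.sum_comp]
    by_cases hAC : A = C <;> simp [ite_and, hAC]
  ext ⟨x₁, x₂⟩ ⟨y₁, y₂⟩
  simp [twoRowMatrix, h, Matrix.one_apply, ← ite_and, and_comm]

theorem twoRowMatrix_succ [Fintype V] (W₁ W₂ : ℕ → S → V → S → V → ℂ) (n : ℕ) (B D : Fin n → V) (b d : V) :
    twoRowMatrix W₁ W₂ (n + 1) (Fin.snoc B b : Fin (n + 1) → V)
        (Fin.snoc D d : Fin (n + 1) → V) =
      twoRowMatrix W₁ W₂ n B D * twoVertexMatrix (W₁ n) (W₂ n) b d := by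
  ext x y
  simp only [twoRowMatrix, twoVertexMatrix, Matrix.mul_apply, Matrix.of_apply]
  rw [← (Fin.snocEquiv fun _ => V).sum_comp]
  simp only [Fin.snocEquiv, Equiv.coe_fn_mk, rowWt_succ, Finset.sum_mul_sum,
    ← Fintype.sum_prod_type']
  exact Fintype.sum_equiv
    ((Equiv.prodComm _ _).trans ((Equiv.refl _).prodCongr (Equiv.prodComm _ _))) _ _
    fun _ => mul_mul_mul_comm _ _ _ _

/-- Local RTT relations, with an `R`-matrix that may vary along the row, imply the RTT relation
for the whole row. -/
theorem mul_twoRowMatrix [Fintype V] (W₁ W₂ : ℕ → S → V → S → V → ℂ) (R : ℕ → Matrix (S × S) (S × S) ℂ)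
    (hR : ∀ t b d, R t * twoVertexMatrix (W₁ t) (W₂ t) b d =
      (twoVertexMatrix (W₂ t) (W₁ t) b d).submatrix Prod.swap Prod.swap * R (t + 1))
    (n : ℕ) (B D : Fin n → V) :
    R 0 * twoRowMatrix W₁ W₂ n B D =
      (twoRowMatrix W₂ W₁ n B D).submatrix Prod.swap Prod.swap * R n := by
  induction n with
  | zero => simp [twoRowMatrix_zero, Matrix.submatrix_one _ Prod.swap_injective]
  | succ n ih =>
    rw [← Fin.snoc_init_self (α := fun _ => V) B, ← Fin.snoc_init_self (α := fun _ => V) D,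
      twoRowMatrix_succ, twoRowMatrix_succ,
      ← Matrix.mul_assoc, ih, Matrix.mul_assoc, hR, ← Matrix.mul_assoc,
      ← Matrix.submatrix_mul _ _ _ _ _ Prod.swap_bijective]

end Row

/-- The ranking in which the color of column `t` (counted from `0`) comes first. -/
def rotatedRank (m t : ℕ) (x : ZMod m) : ℕ := (x - (t + 1 : ℕ)).val

theorem rotatedRank_self {m t : ℕ} : rotatedRank m t ((t + 1 : ℕ) : ZMod m) = 0 := by
  simp [rotatedRank]

theorem rotatedRank_pos {m t : ℕ} [NeZero m] {x : ZMod m} (hx : x ≠ (t + 1 : ℕ)) :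
    0 < rotatedRank m t x :=
  ZMod.val_pos.2 (sub_ne_zero.2 hx)

theorem rotatedRank_succ_self {m t : ℕ} [NeZero m] :
    rotatedRank m (t + 1) ((t + 1 : ℕ) : ZMod m) = m - 1 := by
  obtain ⟨k, rfl⟩ := Nat.exists_eq_succ_of_ne_zero (NeZero.ne m)
  have : (((t + 1 : ℕ) : ZMod (k + 1)) - ((t + 1 + 1 : ℕ) : ZMod (k + 1))) = -1 := by
    push_cast; ring
  rw [rotatedRank, this, ZMod.val_neg_one, Nat.succ_sub_one]

theorem rotatedRank_succ {m t : ℕ} [NeZero m] {x : ZMod m} (hx : x ≠ (t + 1 : ℕ)) :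
    rotatedRank m (t + 1) x + 1 = rotatedRank m t x := by
  have hy := rotatedRank_pos hx
  have hlt : rotatedRank m t x - 1 < m := (Nat.sub_le _ _).trans_lt (ZMod.val_lt _)
  have : x - ((t + 1 + 1 : ℕ) : ZMod m) = ((rotatedRank m t x - 1 : ℕ) : ZMod m) := by
    rw [Nat.cast_sub hy, rotatedRank, ZMod.natCast_zmod_val]
    push_cast
    ring
  rw [rotatedRank, this, ZMod.val_natCast_of_lt hlt, Nat.sub_add_cancel hy]

/-- The vertical boundary spins of a row of `m` columns determined by a set of colors. -/
def boundary (m : ℕ) (B : Finset (ZMod m)) (t : Fin m) : Bool :=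
  decide (((t + 1 : ℕ) : ZMod m) ∈ B)

theorem boundary_bijective (m : ℕ) [NeZero m] : Function.Bijective (boundary m) := by
  refine (Fintype.bijective_iff_injective_and_card _).2 ⟨fun B D h => ?_, by simp [ZMod.card]⟩
  ext x
  have hx := congrFun h ⟨(x - 1).val, ZMod.val_lt _⟩
  simpa [boundary] using hx

/-- The weight of the vertex in column `t` (counted from `0`). -/
def columnWt (m : ℕ) (q Φ : ℂ) (α : ZMod m → ZMod m → ℂ) (z : ℂ) (t : ℕ) (A : Spin m) (b : Bool)
    (C : Spin m) (d : Bool) : ℂ :=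
  wt m q Φ α ((t + 1 : ℕ) : ZMod m) z A (verticalSpin ((t + 1 : ℕ) : ZMod m) b) C
    (verticalSpin ((t + 1 : ℕ) : ZMod m) d)

theorem fusedWt_eq_rowWt (m : ℕ) [NeZero m] (q Φ : ℂ) (α : ZMod m → ZMod m → ℂ) (z : ℂ)
    (A : Spin m) (B : Finset (ZMod m)) (C : Spin m) (D : Finset (ZMod m)) :
    fusedWt m q Φ α z A B C D =
      rowWt (columnWt m q Φ α z) m A (boundary m B) C (boundary m D) := by
  simp only [fusedWt, rowWt, columnWt, verticalSpin, boundary, decide_eq_true_eq]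

theorem sum_fusedWt_mul_fusedWt (m : ℕ) [NeZero m] (q Φ : ℂ) (α : ZMod m → ZMod m → ℂ) (z w : ℂ)
    (x y : Spin m × Spin m) (B D : Finset (ZMod m)) :
    ∑ K, fusedWt m q Φ α z x.1 B y.1 K * fusedWt m q Φ α w x.2 K y.2 D =
      twoRowMatrix (columnWt m q Φ α z) (columnWt m q Φ α w) m (boundary m B) (boundary m D) x y :=
    by
  simp only [fusedWt_eq_rowWt, twoRowMatrix, Matrix.of_apply]
  exact (boundary_bijective m).sum_comp fun K =>
    rowWt (columnWt m q Φ α z) m x.1 (boundary m B) y.1 K *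
      rowWt (columnWt m q Φ α w) m x.2 K y.2 (boundary m D)

/-- The R-matrix with colors compared through `r`, as an operator on pairs of spins. -/
def rankedRMatrix {m : ℕ} (r : ZMod m → ℕ) (q Φ : ℂ) (α : ZMod m → ZMod m → ℂ) (z w : ℂ) :
    Matrix (Spin m × Spin m) (Spin m × Spin m) ℂ :=
  Matrix.of fun x y => rankedR r q Φ α z w x.1 x.2 y.1 y.2

theorem rankedRMatrix_mul_twoVertexMatrix {m : ℕ} [NeZero m] {q Φ : ℂ} (hq : q ≠ 0) (hΦ : Φ ≠ 0)
    {α : ZMod m → ZMod m → ℂ} (hα : ∀ x y, α x y * α y x = 1) (z w : ℂ) (t : ℕ) (b d : Bool) :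
    rankedRMatrix (rotatedRank m t) q Φ α z w *
        twoVertexMatrix (columnWt m q Φ α z t) (columnWt m q Φ α w t) b d =
      (twoVertexMatrix (columnWt m q Φ α w t) (columnWt m q Φ α z t) b d).submatrix
          Prod.swap Prod.swap *
        rankedRMatrix (rotatedRank m (t + 1)) q Φ α z w := by
  ext x y
  simp only [Matrix.mul_apply, Matrix.submatrix_apply, rankedRMatrix, twoVertexMatrix, columnWt,
    Matrix.of_apply, Prod.fst_swap, Prod.snd_swap, Fintype.sum_prod_type, Finset.mul_sum,
    Finset.sum_mul]
  refine column_RTT hq hΦ α hα z w _ _ _ (fun k hk => ?_) (fun k hk => ?_) (fun k l hk hl => ?_)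
    _ _ _ _ _ _
  · rw [rotatedRank_self]
    exact rotatedRank_pos hk
  · have h₁ := rotatedRank_succ hk
    have h₂ : rotatedRank m t k < m := ZMod.val_lt _
    rw [rotatedRank_succ_self]
    omega
  · have h₁ := rotatedRank_succ hk
    have h₂ := rotatedRank_succ hl
    omega

theorem Rf_eq_rankedRMatrix_zero (m : ℕ) (q Φ : ℂ) (α : ZMod m → ZMod m → ℂ) (z w : ℂ)
    (a b c d : Spin m) :
    Rf m q Φ α z w a b c d = rankedRMatrix (rotatedRank m 0) q Φ α z w (a, b) (c, d) := by
  rw [Rf_eq_rankedR, rankedRMatrix, Matrix.of_apply,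
    rankedR_congr (r' := rotatedRank m 0) (by simp [rep, rotatedRank])]

theorem rotatedRank_period (m : ℕ) : rotatedRank m m = rotatedRank m 0 := by
  funext x
  simp [rotatedRank]

/-- fused RTT Yang–Baxter equation:
`∑ R(z₁,z₂)(a,b;i,j) wt^{z₁}(i,C,d,K) wt^{z₂}(j,K,e,F)
 = ∑ wt^{z₂}(b,C,l,N) wt^{z₁}(a,N,m',F) R(z₁,z₂)(m',l;d,e)`. -/
theorem fused_RTT_yang_baxter
    (m : ℕ) [NeZero m] (q Φ : ℂ) (hq : q ≠ 0) (hΦ : Φ ≠ 0)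
    (α : ZMod m → ZMod m → ℂ) (hα : ∀ x y, α x y * α y x = 1) (hα1 : ∀ x, α x x = 1)
    (z1 z2 : ℂ) (hz1 : z1 ≠ 0) (hz2 : z2 ≠ 0)
    (a b d e : Spin m) (C F : Finset (ZMod m)) :
    (∑ i : Spin m, ∑ j : Spin m, ∑ K : Finset (ZMod m),
        Rf m q Φ α z1 z2 a b i j * fusedWt m q Φ α z1 i C d K *
          fusedWt m q Φ α z2 j K e F) =
      ∑ l : Spin m, ∑ m' : Spin m, ∑ Nn : Finset (ZMod m),
        fusedWt m q Φ α z2 b C l Nn * fusedWt m q Φ α z1 a Nn m' F *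
          Rf m q Φ α z1 z2 m' l d e := by
  have key := congrFun₂ (mul_twoRowMatrix (columnWt m q Φ α z1) (columnWt m q Φ α z2)
    (fun t => rankedRMatrix (rotatedRank m t) q Φ α z1 z2)
    (rankedRMatrix_mul_twoVertexMatrix hq hΦ hα z1 z2) m (boundary m C) (boundary m F))
    (a, b) (d, e)
  simp only [rotatedRank_period, Matrix.mul_apply, Matrix.submatrix_apply,
    ← sum_fusedWt_mul_fusedWt, Fintype.sum_prod_type, Finset.mul_sum, Finset.sum_mul,
    Prod.swap_prod_mk, ← Rf_eq_rankedRMatrix_zero, ← mul_assoc] at key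
  rw [key, Finset.sum_comm]
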